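/- arXiv:1705.06603 — 3 statements merged into one kernel-verified Lean document; each statement's English description precedes it below -/
import Mathlib

section
/- Let E be a finite-dimensional real inner product space, let f : E → ℝ be convex and continuous, and let u ∈ E. Then the function w ↦ f(w) + (1/2)‖w − u‖² attains its minimum over E at a unique point (so the proximity operator Prox_f(u) of f at u is well defined). -/
/-- A continuous convex function on a finite-dimensional normed space decreases at most linearly
away from any point. -/
lemma ConvexOn.exists_sub_mul_norm_le {E : Type*} [NormedAddCommGroup E]
    [NormedSpace ℝ E] [FiniteDimensional ℝ E] {f : E → ℝ}
    (hf : ConvexOn ℝ Set.univ f) (hfc : Continuous f) (u : E) :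
    ∃ c : ℝ, ∀ w : E, 1 ≤ ‖w - u‖ → f u - c * ‖w - u‖ ≤ f w := by
  have : ProperSpace E := FiniteDimensional.proper_real E
  obtain ⟨p, -, hp⟩ := (isCompact_closedBall u 1).exists_isMinOn
    ⟨u, Metric.mem_closedBall_self zero_le_one⟩ hfc.continuousOn
  refine ⟨f u - f p, fun w hw => ?_⟩
  set r := ‖w - u‖ with hr
  have hr0 : 0 < r := by linarith
  have hmem : (1 - r⁻¹) • u + r⁻¹ • w ∈ Metric.closedBall u 1 := by
    have : (1 - r⁻¹) • u + r⁻¹ • w - u = r⁻¹ • (w - u) := by module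
    rw [mem_closedBall_iff_norm, this, norm_smul, ← hr, norm_inv, Real.norm_of_nonneg hr0.le,
      inv_mul_cancel₀ hr0.ne']
  have hmin : f p ≤ f ((1 - r⁻¹) • u + r⁻¹ • w) := hp hmem
  have hconv := hf.2 (Set.mem_univ u) (Set.mem_univ w)
    (sub_nonneg.2 (inv_le_one_of_one_le₀ hw)) (inv_nonneg.2 hr0.le) (sub_add_cancel 1 r⁻¹)
  simp only [smul_eq_mul] at hconv
  have hmul := mul_le_mul_of_nonneg_left (hmin.trans hconv) hr0.le
  have hexp : r * ((1 - r⁻¹) * f u + r⁻¹ * f w) = r * f u - f u + f w := by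
    field_simp
  linarith

/-- on a finite-dimensional real inner product space `E`, for any
convex continuous `f : E → ℝ` and any `u ∈ E`, the function
`w ↦ f(w) + (1/2)‖w − u‖²` attains its minimum over `E` at a unique point, so the
proximity operator `Prox_f(u)` is well defined. -/
theorem prox_exists_unique {E : Type*} [NormedAddCommGroup E]
    [InnerProductSpace ℝ E] [FiniteDimensional ℝ E]
    (f : E → ℝ) (hf : ConvexOn ℝ Set.univ f) (hfc : Continuous f) (u : E) :
    ∃! x : E, ∀ w : E,
      f x + (1 / 2) * ‖x - u‖ ^ 2 ≤ f w + (1 / 2) * ‖w - u‖ ^ 2 := by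
  have : ProperSpace E := FiniteDimensional.proper_real E
  refine existsUnique_of_exists_of_unique ?_ fun x y hx hy => ?_
  · obtain ⟨c, hc⟩ := hf.exists_sub_mul_norm_le hfc u
    have hcont : Continuous fun w : E => f w + (1 / 2) * ‖w - u‖ ^ 2 := by fun_prop
    refine hcont.exists_forall_le' u ?_
    filter_upwards [(isCompact_closedBall u (max 1 (2 * c))).compl_mem_cocompact] with w hw
    have hlt : max 1 (2 * c) < ‖w - u‖ := by
      simpa only [Set.mem_compl_iff, mem_closedBall_iff_norm, not_le] using hw
    obtain ⟨h1, h2⟩ := max_lt_iff.1 hlt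
    have hw := hc w h1.le
    simp only [sub_self, norm_zero]
    nlinarith
  · have hconv := hf.2 (Set.mem_univ x) (Set.mem_univ y)
      (by norm_num : (0 : ℝ) ≤ 1 / 2) (by norm_num : (0 : ℝ) ≤ 1 / 2) (by norm_num)
    simp only [smul_eq_mul] at hconv
    have hx' := hx ((1 / 2 : ℝ) • x + (1 / 2 : ℝ) • y)
    have hy' := hy ((1 / 2 : ℝ) • x + (1 / 2 : ℝ) • y)
    have hmid : (1 / 2 : ℝ) • x + (1 / 2 : ℝ) • y - u = (1 / 2 : ℝ) • ((x - u) + (y - u)) := by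
      module
    have hnorm : ‖(1 / 2 : ℝ) • x + (1 / 2 : ℝ) • y - u‖ ^ 2
        = (1 / 4) * ‖(x - u) + (y - u)‖ ^ 2 := by
      rw [hmid, norm_smul, mul_pow]
      norm_num
    have hpar := parallelogram_law_with_norm ℝ (x - u) (y - u)
    rw [sub_sub_sub_cancel_right] at hpar
    rw [hnorm] at hx' hy'
    have hzero : ‖x - y‖ ^ 2 ≤ 0 := by nlinarith
    exact sub_eq_zero.1 (norm_eq_zero.1 (pow_eq_zero_iff two_ne_zero |>.1
      (le_antisymm hzero (sq_nonneg _))))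
end

section
/- Let E be a finite-dimensional real inner product space, let f : E → ℝ be convex and continuous, and let C ⊆ E be a nonempty closed convex set. Let u ∈ E, let x ∈ E be the unique minimizer over E of w ↦ f(w) + (1/2)‖w − u‖², and suppose that the metric projection of 2x − u onto C equals x (i.e., x is the unique minimizer over w ∈ C of ‖w − (2x − u)‖²). Then x ∈ C and x minimizes f over C, i.e., f(x) ≤ f(w) for every w ∈ C. -/
/-- A real number bounded by `t * c` for all `t ∈ (0, 1]`, where `0 ≤ c`, is nonpositive. -/
theorem nonpos_of_forall_le_mul {a c : ℝ} (hc : 0 ≤ c)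
    (h : ∀ t : ℝ, 0 < t → t ≤ 1 → a ≤ t * c) : a ≤ 0 := by
  by_contra! ha
  have hac : 0 < a + c := by linarith
  have key := h (a / (a + c)) (by positivity) ((div_le_one hac).2 (by linarith))
  rw [div_mul_eq_mul_div, le_div_iff₀ hac] at key
  nlinarith [mul_pos ha ha]

/-- fixed-point property of Douglas–Rachford splitting. If `x` is the
unique minimizer over `E` of `w ↦ f(w) + (1/2)‖w − u‖²` (the prox of `f` at `u`)
and the metric projection of `2x − u` onto the nonempty closed convex set `C`
equals `x` (i.e. `x ∈ C` and `x` minimizes `‖w − (2x − u)‖²` over `w ∈ C`), then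
`x ∈ C` and `x` minimizes `f` over `C`. -/
theorem douglas_rachford_fixed_point {E : Type*} [NormedAddCommGroup E]
    [InnerProductSpace ℝ E] [FiniteDimensional ℝ E]
    (f : E → ℝ) (hf : ConvexOn ℝ Set.univ f) (hfc : Continuous f)
    (C : Set E) (hCne : C.Nonempty) (hCcl : IsClosed C) (hCcv : Convex ℝ C)
    (u x : E)
    (hprox : ∀ w : E, f x + (1 / 2) * ‖x - u‖ ^ 2 ≤ f w + (1 / 2) * ‖w - u‖ ^ 2)
    (hproj_mem : x ∈ C)
    (hproj : ∀ w ∈ C, ‖x - ((2 : ℝ) • x - u)‖ ^ 2 ≤ ‖w - ((2 : ℝ) • x - u)‖ ^ 2) :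
    x ∈ C ∧ ∀ w ∈ C, f x ≤ f w := by
  refine ⟨hproj_mem, fun w hw => sub_nonpos.1 ?_⟩
  refine nonpos_of_forall_le_mul (sq_nonneg ‖w - x‖) fun t ht ht1 => ?_
  have hline : x + t • (w - x) = (1 - t) • x + t • w := by module
  have hmem : x + t • (w - x) ∈ C :=
    hCcv.add_smul_sub_mem hproj_mem hw ⟨ht.le, ht1⟩
  have hconv : f (x + t • (w - x)) ≤ (1 - t) * f x + t * f w := by
    rw [hline]
    exact hf.2 (Set.mem_univ x) (Set.mem_univ w) (by linarith) ht.le (by ring)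
  have h₁ := hprox (x + t • (w - x))
  have h₂ := hproj _ hmem
  rw [show x + t • (w - x) - u = (x - u) + t • (w - x) by abel, norm_add_sq_real,
    inner_smul_right, norm_smul, mul_pow, Real.norm_eq_abs, sq_abs] at h₁
  rw [show x - ((2 : ℝ) • x - u) = -(x - u) by module, norm_neg,
    show x + t • (w - x) - ((2 : ℝ) • x - u) = t • (w - x) - (x - u) by module,
    norm_sub_sq_real (t • (w - x)) (x - u), real_inner_smul_left, real_inner_comm,
    norm_smul, mul_pow, Real.norm_eq_abs, sq_abs] at h₂
  refine le_of_mul_le_mul_left ?_ ht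
  linarith
end

section
/- Let E be a finite-dimensional real inner product space, let f : E → ℝ be convex and continuous, and let C ⊆ E be a nonempty closed convex set such that the set of minimizers of f over C is nonempty. Let (ρ_k)_{k≥0} be a sequence in the open interval (0, 2) with Σ_k ρ_k (2 − ρ_k) = +∞, and let (e1_k)_{k≥0} and (e2_k)_{k≥0} be sequences in E with Σ_k (‖e1_k‖ + ‖e2_k‖) < +∞. Starting from any u_0 ∈ E, define for every k ≥ 0: x_{k+1} = Prox_f(u_k) + e1_k, where Prox_f(v) denotes the unique minimizer over E of w ↦ f(w) + (1/2)‖w − v‖²; z_{k+1} = proj_C(2 x_{k+1} − u_k) + e2_k, where proj_C(v) denotes the metric projection of v onto C; and u_{k+1} = u_k + ρ_k (z_{k+1} − x_{k+1}). Then the sequence (u_k) converges to some point u* ∈ E, and the sequence (x_k) converges to a minimizer of f over C. -/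
open Filter Topology in
/-- A nonnegative sequence that increases by at most a summable amount at each step converges. -/
theorem exists_tendsto_of_le_add_summable {a ε : ℕ → ℝ} (ha : ∀ k, 0 ≤ a k)
    (hε : ∀ k, 0 ≤ ε k) (hs : Summable ε) (h : ∀ k, a (k + 1) ≤ a k + ε k) :
    ∃ l, Tendsto a atTop (𝓝 l) := by
  have hanti : Antitone fun k => a k - ∑ i ∈ Finset.range k, ε i := by
    refine antitone_nat_of_succ_le fun k => ?_
    rw [Finset.sum_range_succ]
    linarith [h k]
  have hbdd : BddBelow (Set.range fun k => a k - ∑ i ∈ Finset.range k, ε i) := by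
    refine ⟨-∑' i, ε i, ?_⟩
    rintro _ ⟨k, rfl⟩
    have := hs.sum_le_tsum (Finset.range k) fun i _ => hε i
    dsimp only
    linarith [ha k]
  refine ⟨_, ((tendsto_atTop_ciInf hanti hbdd).add hs.hasSum.tendsto_sum_nat).congr fun k => ?_⟩
  ring

open Filter Topology in
/-- In a perturbed Fejér-type inequality whose weights `τ` have divergent sum, the residuals `d`
are frequently arbitrarily small. -/
theorem frequently_lt_of_perturbed_fejer {a b ε τ d : ℕ → ℝ} (ha : ∀ k, 0 ≤ a k)
    (hb : ∀ k, 0 ≤ b k) (hε : ∀ k, 0 ≤ ε k) (hs : Summable ε) (hτ : ∀ k, 0 ≤ τ k)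
    (hτdiv : Tendsto (fun m => ∑ k ∈ Finset.range m, τ k) atTop atTop)
    (h : ∀ k, a (k + 1) ≤ b k + ε k) (hab : ∀ k, b k ^ 2 ≤ a k ^ 2 - τ k * d k ^ 2)
    {η : ℝ} (hη : 0 < η) : ∃ᶠ k in atTop, d k < η := by
  have hba : ∀ k, b k ≤ a k := fun k =>
    (abs_le_of_sq_le_sq' (by nlinarith [hab k, mul_nonneg (hτ k) (sq_nonneg (d k))]) (ha k)).2
  obtain ⟨l, hl⟩ := exists_tendsto_of_le_add_summable ha hε hs
    fun k => (h k).trans (by linarith [hba k])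
  obtain ⟨M, hM⟩ := hl.bddAbove_range
  have haM : ∀ k, a k ≤ M := fun k => hM ⟨k, rfl⟩
  have hstep : ∀ k, a (k + 1) ^ 2 ≤ a k ^ 2 - τ k * d k ^ 2 + 2 * M * ε k := by
    intro k
    nlinarith [hab k, h k, haM k, haM (k + 1), ha (k + 1), hb k, hba k, hε k]
  rw [Filter.Frequently]
  intro hev
  obtain ⟨N, hN⟩ := eventually_atTop.1 hev
  have hsum : ∀ m, a (N + m) ^ 2 + η ^ 2 * ∑ k ∈ Finset.range (N + m), τ k ≤
      a N ^ 2 + η ^ 2 * ∑ k ∈ Finset.range N, τ k +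
        2 * M * (∑ k ∈ Finset.range (N + m), ε k - ∑ k ∈ Finset.range N, ε k) := by
    intro m
    induction m with
    | zero => simp
    | succ m ih =>
      have h1 := hstep (N + m)
      have h2 : η ≤ d (N + m) := not_lt.1 (hN (N + m) (by omega))
      have h3 : τ (N + m) * η ^ 2 ≤ τ (N + m) * d (N + m) ^ 2 :=
        mul_le_mul_of_nonneg_left (pow_le_pow_left₀ hη.le h2 2) (hτ _)
      rw [← add_assoc, Finset.sum_range_succ, Finset.sum_range_succ]
      linarith
  have hM0 : 0 ≤ M := (ha 0).trans (haM 0)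
  set B := a N ^ 2 + η ^ 2 * ∑ k ∈ Finset.range N, τ k + 2 * M * ∑' k, ε k with hB
  obtain ⟨m, hm, hNm⟩ :=
    ((hτdiv.eventually_gt_atTop (B / η ^ 2)).and (eventually_ge_atTop N)).exists
  obtain ⟨j, rfl⟩ := Nat.exists_eq_add_of_le hNm
  rw [div_lt_iff₀ (by positivity)] at hm
  have h1 := hsum j
  have h2 := hs.sum_le_tsum (Finset.range (N + j)) fun i _ => hε i
  have h3 : 0 ≤ ∑ k ∈ Finset.range N, ε k := Finset.sum_nonneg fun i _ => hε i
  have h4 : 2 * M * (∑ k ∈ Finset.range (N + j), ε k - ∑ k ∈ Finset.range N, ε k) ≤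
      2 * M * ∑' k, ε k := mul_le_mul_of_nonneg_left (by linarith) (by linarith)
  nlinarith [sq_nonneg (a (N + j))]

theorem nonneg_of_forall_mul_add_sq_mul_nonneg {a b : ℝ}
    (h : ∀ t : ℝ, 0 < t → t ≤ 1 → 0 ≤ t * a + t ^ 2 * b) : 0 ≤ a := by
  by_contra! ha
  have hb : 0 < 1 + |b| + |a| := by positivity
  have ha' : |a| = -a := abs_of_neg ha
  have ht : 0 < -a / (2 * (1 + |b| + |a|)) := div_pos (by linarith) (by linarith)
  have h1 := h _ ht (by
    rw [div_le_one (by linarith)]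
    linarith [abs_nonneg b])
  set t := -a / (2 * (1 + |b| + |a|)) with htdef
  have h2 : t * (2 * (1 + |b| + |a|)) = -a := by
    rw [htdef]; field_simp
  have h3 : 0 ≤ a + t * b := by
    by_contra! hc
    nlinarith
  nlinarith [le_abs_self b, abs_nonneg b, abs_nonneg a]

section Hilbert

variable {E : Type*} [NormedAddCommGroup E] [InnerProductSpace ℝ E]

/-- `g` is a subgradient of `f` at `p`. -/
def IsSubgradientAt (f : E → ℝ) (g p : E) : Prop := ∀ w, f p + inner ℝ g (w - p) ≤ f w

/-- `q` is the point of `C` whose residual `v - q` is normal to `C`, i.e. the projection of `v`. -/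
def IsProjection (C : Set E) (v q : E) : Prop := q ∈ C ∧ ∀ w ∈ C, inner ℝ (v - q) (w - q) ≤ 0

/-- `v` is a fixed point of the Douglas–Rachford operator of `f` and `C`, with shadow point `p`. -/
def IsDouglasRachfordFixed (f : E → ℝ) (C : Set E) (v p : E) : Prop :=
  IsSubgradientAt f (v - p) p ∧ IsProjection C ((2 : ℝ) • p - v) p

theorem isSubgradientAt_of_prox {f : E → ℝ} (hf : ConvexOn ℝ Set.univ f) {v p : E}
    (h : ∀ w, f p + (1 / 2) * ‖p - v‖ ^ 2 ≤ f w + (1 / 2) * ‖w - v‖ ^ 2) :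
    IsSubgradientAt f (v - p) p := by
  intro w
  have key : 0 ≤ f w - f p - inner ℝ (v - p) (w - p) := by
    refine nonneg_of_forall_mul_add_sq_mul_nonneg (b := 1 / 2 * ‖w - p‖ ^ 2) fun t ht ht1 => ?_
    have h1 := h ((1 - t) • p + t • w)
    have h2 := hf.2 (Set.mem_univ p) (Set.mem_univ w) (sub_nonneg.2 ht1) ht.le (by ring)
    have h3 : (1 - t) • p + t • w - v = t • (w - p) - (v - p) := by module
    rw [h3, norm_sub_rev p v, norm_sub_sq_real (t • _), norm_smul, inner_smul_left, mul_pow,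
      Real.norm_eq_abs, sq_abs, real_inner_comm] at h1
    simp only [smul_eq_mul, conj_trivial] at h1 h2
    nlinarith
  linarith

theorem isProjection_of_norm_sq_le {C : Set E} (hC : Convex ℝ C) {v q : E} (hq : q ∈ C)
    (h : ∀ w ∈ C, ‖q - v‖ ^ 2 ≤ ‖w - v‖ ^ 2) : IsProjection C v q := by
  refine ⟨hq, fun w hw => ?_⟩
  have key : 0 ≤ -inner ℝ (v - q) (w - q) := by
    refine nonneg_of_forall_mul_add_sq_mul_nonneg (b := 1 / 2 * ‖w - q‖ ^ 2) fun t ht ht1 => ?_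
    have h1 := h _ (hC hq hw (sub_nonneg.2 ht1) ht.le (by ring))
    have h3 : (1 - t) • q + t • w - v = t • (w - q) - (v - q) := by module
    rw [h3, norm_sub_rev q v, norm_sub_sq_real (t • _), norm_smul, inner_smul_left, mul_pow,
      Real.norm_eq_abs, sq_abs, real_inner_comm] at h1
    simp only [conj_trivial] at h1
    nlinarith
  linarith

theorem exists_isProjection {C : Set E} (hne : C.Nonempty) (hcl : IsComplete C)
    (hC : Convex ℝ C) (v : E) : ∃ q, IsProjection C v q := by
  obtain ⟨q, hq, h⟩ := exists_norm_eq_iInf_of_complete_convex hne hcl hC v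
  exact ⟨q, hq, (norm_eq_iInf_iff_real_inner_le_zero hC hq).1 h⟩

theorem norm_le_norm_of_inner_sub_nonneg {a b : E} (h : 0 ≤ inner ℝ (a - b) b) : ‖b‖ ≤ ‖a‖ := by
  rw [inner_sub_left, real_inner_self_eq_norm_sq] at h
  have h1 := real_inner_le_norm a b
  by_contra! hc
  nlinarith [norm_nonneg a, norm_nonneg b]

theorem IsProjection.norm_sub_le {C : Set E} {v v' q q' : E} (h : IsProjection C v q)
    (h' : IsProjection C v' q') : ‖q - q'‖ ≤ ‖v - v'‖ := by
  apply norm_le_norm_of_inner_sub_nonneg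
  have h1 := h.2 q' h'.1
  have h2 := h'.2 q h.1
  simp only [inner_sub_left, inner_sub_right] at *
  linarith

theorem IsSubgradientAt.inner_nonneg {f : E → ℝ} {g g' p p' : E} (h : IsSubgradientAt f g p)
    (h' : IsSubgradientAt f g' p') : 0 ≤ inner ℝ (g - g') (p - p') := by
  have h1 := h p'
  have h2 := h' p
  simp only [inner_sub_left, inner_sub_right] at *
  linarith

/-- The proximity operator is nonexpansive. -/
theorem IsSubgradientAt.norm_sub_le {f : E → ℝ} {v v' p p' : E} (h : IsSubgradientAt f (v - p) p)
    (h' : IsSubgradientAt f (v' - p') p') : ‖p - p'‖ ≤ ‖v - v'‖ := by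
  apply norm_le_norm_of_inner_sub_nonneg
  have h1 := h.inner_nonneg h'
  rwa [sub_sub_sub_comm] at h1

theorem IsDouglasRachfordFixed.isMinOn {f : E → ℝ} {C : Set E} {v p : E}
    (h : IsDouglasRachfordFixed f C v p) : IsMinOn f C p := by
  intro w hw
  have h1 := h.1 w
  have h2 := h.2.2 w hw
  rw [show (2 : ℝ) • p - v - p = -(v - p) by module, inner_neg_left] at h2
  simp only [Set.mem_ofPred_eq]
  linarith

/-- Firm quasi-nonexpansiveness of the Douglas–Rachford operator. -/
theorem IsDouglasRachfordFixed.inner_le {f : E → ℝ} {C : Set E} {v p v' p' q : E}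
    (h : IsDouglasRachfordFixed f C v p) (hp : IsSubgradientAt f (v' - p') p')
    (hq : IsProjection C ((2 : ℝ) • p' - v') q) :
    inner ℝ (v' - v) (q - p') ≤ -‖q - p'‖ ^ 2 := by
  have h1 := hp.inner_nonneg h.1
  have h2 := hq.2 p h.2.1
  have h3 := h.2.2 q hq.1
  rw [← real_inner_self_eq_norm_sq]
  simp only [inner_sub_left, inner_sub_right, inner_smul_left, conj_trivial] at *
  linarith [real_inner_comm p q, real_inner_comm p p', real_inner_comm q p',
    real_inner_comm p v, real_inner_comm p v']

theorem IsDouglasRachfordFixed.norm_relaxed_sub_sq_le {f : E → ℝ} {C : Set E} {v p v' p' q : E}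
    (h : IsDouglasRachfordFixed f C v p) (hp : IsSubgradientAt f (v' - p') p')
    (hq : IsProjection C ((2 : ℝ) • p' - v') q) {r : ℝ} (hr : 0 ≤ r) :
    ‖v' + r • (q - p') - v‖ ^ 2 ≤ ‖v' - v‖ ^ 2 - r * (2 - r) * ‖q - p'‖ ^ 2 := by
  have h1 := h.inner_le hp hq
  rw [show v' + r • (q - p') - v = (v' - v) + r • (q - p') by abel, norm_add_sq_real,
    inner_smul_right, norm_smul, mul_pow, Real.norm_eq_abs, sq_abs]
  nlinarith

/-- A constrained minimizer of a continuous convex function is the shadow of a fixed point of the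
Douglas–Rachford operator. -/
theorem exists_isDouglasRachfordFixed [CompleteSpace E] {f : E → ℝ}
    (hf : ConvexOn ℝ Set.univ f) (hfc : Continuous f) {C : Set E} (hC : Convex ℝ C) {p : E}
    (hp : p ∈ C) (hmin : ∀ w ∈ C, f p ≤ f w) : ∃ v, IsDouglasRachfordFixed f C v p := by
  have hA : Convex ℝ {y : E × ℝ | f y.1 < y.2} := by
    simpa using hf.convex_strict_epigraph
  have hAo : IsOpen {y : E × ℝ | f y.1 < y.2} :=
    isOpen_lt (hfc.comp continuous_fst) continuous_snd
  have hB : Convex ℝ (C ×ˢ Set.Iic (f p)) := hC.prod (convex_Iic _)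
  have hd : Disjoint {y : E × ℝ | f y.1 < y.2} (C ×ˢ Set.Iic (f p)) := by
    rw [Set.disjoint_left]
    rintro ⟨w, t⟩ h1 ⟨h2, h3⟩
    have := hmin w h2
    simp only [Set.mem_ofPred_eq, Set.mem_Iic] at h1 h3
    linarith
  obtain ⟨φ, s, hφA, hφB⟩ := geometric_hahn_banach_open hA hAo hB hd
  set ψ : E →L[ℝ] ℝ := φ.comp (ContinuousLinearMap.inl ℝ E ℝ) with hψ
  set c : ℝ := φ (0, 1) with hc
  have hφ : ∀ (w : E) (t : ℝ), φ (w, t) = ψ w + t * c := by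
    intro w t
    have : ((w, t) : E × ℝ) = (w, 0) + t • (0, 1) := by simp
    rw [this, map_add, map_smul]
    simp [hψ, hc]
  have hA' : ∀ w t, f w < t → ψ w + t * c < s := fun w t ht => hφ w t ▸ hφA (w, t) ht
  have hB' : ∀ w ∈ C, s ≤ ψ w + f p * c := fun w hw =>
    hφ w (f p) ▸ hφB (w, f p) ⟨hw, le_refl (f p)⟩
  have hc0 : c < 0 := by
    have h1 := hA' p (f p + 1) (by linarith)
    have h2 := hB' p hp
    linarith
  have hA'' : ∀ w, ψ w + f w * c ≤ s := by
    intro w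
    refine le_of_forall_pos_le_add fun δ hδ => ?_
    have h1 := hA' w (f w + δ / (-c)) (by linarith [div_pos hδ (neg_pos.2 hc0)])
    have h2 : δ / (-c) * c = -δ := by rw [div_neg, neg_mul, div_mul_cancel₀ _ hc0.ne]
    linarith
  have hs : s = ψ p + f p * c := le_antisymm (hB' p hp) (hA'' p)
  set g : E := (InnerProductSpace.toDual ℝ E).symm ((-c)⁻¹ • ψ) with hg
  have hgw : ∀ w, inner ℝ g w = (-c)⁻¹ * ψ w := fun w => by
    rw [hg, InnerProductSpace.toDual_symm_apply]
    simp
  have hci : 0 < (-c)⁻¹ := inv_pos.2 (neg_pos.2 hc0)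
  refine ⟨p + g, fun w => ?_, hp, fun w hw => ?_⟩
  · rw [add_sub_cancel_left, hgw, map_sub]
    have h1 : ψ w - ψ p ≤ (-c) * (f w - f p) := by linarith [hA'' w]
    have h2 := mul_le_mul_of_nonneg_left h1 hci.le
    rw [inv_mul_cancel_left₀ (by linarith)] at h2
    linarith
  · rw [show (2 : ℝ) • p - (p + g) - p = -g by module, inner_neg_left, hgw, map_sub]
    have h1 := hB' w hw
    have := mul_nonneg hci.le (show 0 ≤ ψ w - ψ p by linarith)
    linarith

open Filter Topology in
/-- Limits of near-fixed points of the Douglas–Rachford operator are fixed points. -/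
theorem isDouglasRachfordFixed_of_tendsto {f : E → ℝ} (hfc : Continuous f) {C : Set E}
    (hC : IsClosed C) {u p q : ℕ → E} {v y : E} (hp : ∀ k, IsSubgradientAt f (u k - p k) (p k))
    (hq : ∀ k, IsProjection C ((2 : ℝ) • p k - u k) (q k)) (hu : Tendsto u atTop (𝓝 v))
    (hpy : Tendsto p atTop (𝓝 y)) (hd : Tendsto (fun k => q k - p k) atTop (𝓝 0)) :
    IsDouglasRachfordFixed f C v y := by
  have hqy : Tendsto q atTop (𝓝 y) := by simpa using hd.add hpy
  refine ⟨fun w => ?_, hC.mem_of_tendsto hqy (Eventually.of_forall fun k => (hq k).1),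
    fun w hw => ?_⟩
  · exact le_of_tendsto (((hfc.tendsto y).comp hpy).add
      ((hu.sub hpy).inner (tendsto_const_nhds.sub hpy))) (Eventually.of_forall fun k => hp k w)
  · exact le_of_tendsto ((((hpy.const_smul (2 : ℝ)).sub hu).sub hqy).inner
      (tendsto_const_nhds.sub hqy)) (Eventually.of_forall fun k => (hq k).2 w hw)

end Hilbert


/-- convergence of the relaxed, inexact Douglas–Rachford splitting
algorithm for minimizing a convex continuous `f : E → ℝ` over a nonempty closed
convex set `C ⊆ E` (finite-dimensional real inner product space), with relaxation
parameters `ρ_k ∈ (0,2)` satisfying `∑ ρ_k (2 − ρ_k) = +∞` and summable errors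
`e1_k, e2_k`. The iterates are
`x_{k+1} = Prox_f(u_k) + e1_k`, `z_{k+1} = proj_C(2 x_{k+1} − u_k) + e2_k`,
`u_{k+1} = u_k + ρ_k (z_{k+1} − x_{k+1})`. Then `(u_k)` converges to some point of
`E` and `(x_k)` converges to a minimizer of `f` over `C`. -/
theorem douglas_rachford_convergence {E : Type*} [NormedAddCommGroup E]
    [InnerProductSpace ℝ E] [FiniteDimensional ℝ E]
    (f : E → ℝ) (hf : ConvexOn ℝ Set.univ f) (hfc : Continuous f)
    (C : Set E) (hCne : C.Nonempty) (hCcl : IsClosed C) (hCcv : Convex ℝ C)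
    (hargmin : ∃ xs ∈ C, ∀ w ∈ C, f xs ≤ f w)
    (ρ : ℕ → ℝ) (hρ : ∀ k, 0 < ρ k ∧ ρ k < 2)
    (hρdiv : Filter.Tendsto (fun m => ∑ k ∈ Finset.range m, ρ k * (2 - ρ k))
      Filter.atTop Filter.atTop)
    (e1 e2 : ℕ → E) (herr : Summable fun k => ‖e1 k‖ + ‖e2 k‖)
    (u x z : ℕ → E)
    -- `x (k+1) − e1 k` is the prox of `f` at `u k`:
    (hx : ∀ k : ℕ, ∀ w : E,
      f (x (k + 1) - e1 k) + (1 / 2) * ‖(x (k + 1) - e1 k) - u k‖ ^ 2 ≤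
        f w + (1 / 2) * ‖w - u k‖ ^ 2)
    -- `z (k+1) − e2 k` is the metric projection of `2 x (k+1) − u k` onto `C`:
    (hz_mem : ∀ k : ℕ, z (k + 1) - e2 k ∈ C)
    (hz : ∀ k : ℕ, ∀ w ∈ C,
      ‖(z (k + 1) - e2 k) - ((2 : ℝ) • x (k + 1) - u k)‖ ^ 2 ≤
        ‖w - ((2 : ℝ) • x (k + 1) - u k)‖ ^ 2)
    (hu : ∀ k : ℕ, u (k + 1) = u k + ρ k • (z (k + 1) - x (k + 1))) :
    (∃ ustar : E, Filter.Tendsto u Filter.atTop (nhds ustar)) ∧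
    (∃ xstar : E, xstar ∈ C ∧ (∀ w ∈ C, f xstar ≤ f w) ∧
      Filter.Tendsto x Filter.atTop (nhds xstar)) := by
  have := FiniteDimensional.complete ℝ E
  have := FiniteDimensional.proper_real E
  set p : ℕ → E := fun k => x (k + 1) - e1 k with hp_def
  have hp : ∀ k, IsSubgradientAt f (u k - p k) (p k) := fun k => isSubgradientAt_of_prox hf (hx k)
  choose q hq using fun k =>
    exists_isProjection hCne hCcl.isComplete hCcv ((2 : ℝ) • p k - u k)
  set ε : ℕ → ℝ := fun k => 6 * (‖e1 k‖ + ‖e2 k‖) with hε_def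
  have hε : ∀ k, 0 ≤ ε k := fun k => by positivity
  have hεs : Summable ε := herr.mul_left 6
  have hτ : ∀ k, 0 ≤ ρ k * (2 - ρ k) := fun k =>
    mul_nonneg (hρ k).1.le (by linarith [(hρ k).2])
  have hstep : ∀ (v : E) (k : ℕ),
      ‖u (k + 1) - v‖ ≤ ‖u k + ρ k • (q k - p k) - v‖ + ε k := by
    intro v k
    have h1 := (isProjection_of_norm_sq_le hCcv (hz_mem k) (hz k)).norm_sub_le (hq k)
    have h2 : (2 : ℝ) • x (k + 1) - u k - ((2 : ℝ) • p k - u k) = (2 : ℝ) • e1 k := by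
      simp only [hp_def]; module
    rw [h2, norm_smul, Real.norm_ofNat] at h1
    have h3 : u (k + 1) - v = (u k + ρ k • (q k - p k) - v) +
        ρ k • ((z (k + 1) - e2 k - q k) + (e2 k - e1 k)) := by
      rw [hu k]; simp only [hp_def]; module
    rw [h3]
    refine (norm_add_le _ _).trans (add_le_add le_rfl ?_)
    rw [norm_smul, Real.norm_eq_abs, abs_of_pos (hρ k).1]
    have h4 : ‖(z (k + 1) - e2 k - q k) + (e2 k - e1 k)‖ ≤ 3 * (‖e1 k‖ + ‖e2 k‖) := by
      refine (norm_add_le _ _).trans ?_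
      linarith [norm_sub_le (e2 k) (e1 k), norm_nonneg (e2 k)]
    calc ρ k * _ ≤ 2 * (3 * (‖e1 k‖ + ‖e2 k‖)) :=
          mul_le_mul (hρ k).2.le h4 (norm_nonneg _) (by norm_num)
      _ = ε k := by simp only [hε_def]; ring
  have hfejer : ∀ v y, IsDouglasRachfordFixed f C v y →
      ∃ l, Filter.Tendsto (fun k => ‖u k - v‖) Filter.atTop (nhds l) := by
    intro v y hv
    refine exists_tendsto_of_le_add_summable (fun _ => norm_nonneg _) hε hεs fun k =>
      (hstep v k).trans (add_le_add ?_ le_rfl)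
    have := hv.norm_relaxed_sub_sq_le (hp k) (hq k) (hρ k).1.le
    exact (abs_le_of_sq_le_sq' (by nlinarith [mul_nonneg (hτ k) (sq_nonneg ‖q k - p k‖)])
      (norm_nonneg _)).2
  obtain ⟨xs, hxs, hmin⟩ := hargmin
  obtain ⟨v₀, hv₀⟩ := exists_isDouglasRachfordFixed hf hfc hCcv hxs hmin
  have hfreq : ∀ n : ℕ, ∃ᶠ k in Filter.atTop, ‖q k - p k‖ < 1 / ((n : ℝ) + 1) := fun n =>
    frequently_lt_of_perturbed_fejer (fun k => norm_nonneg (u k - v₀)) (fun _ => norm_nonneg _) hε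
      hεs hτ hρdiv (hstep v₀)
      (fun k => hv₀.norm_relaxed_sub_sq_le (hp k) (hq k) (hρ k).1.le) (by positivity)
  obtain ⟨φ, hφ, hφd⟩ := Filter.extraction_forall_of_frequently hfreq
  have hd : Filter.Tendsto (fun n => q (φ n) - p (φ n)) Filter.atTop (nhds 0) :=
    squeeze_zero_norm (fun n => (hφd n).le) tendsto_one_div_add_atTop_nhds_zero_nat
  obtain ⟨l₀, hl₀⟩ := hfejer v₀ xs hv₀
  obtain ⟨M, hM⟩ := hl₀.bddAbove_range
  have hbdd : ∀ n, (u (φ n), p (φ n)) ∈ Metric.closedBall v₀ M ×ˢ Metric.closedBall xs M := by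
    intro n
    have h1 : ‖u (φ n) - v₀‖ ≤ M := hM ⟨φ n, rfl⟩
    exact ⟨mem_closedBall_iff_norm.2 h1,
      mem_closedBall_iff_norm.2 (((hp _).norm_sub_le hv₀.1).trans h1)⟩
  obtain ⟨⟨v, y⟩, -, θ, hθ, hlim⟩ :=
    ((isCompact_closedBall v₀ M).prod (isCompact_closedBall xs M)).tendsto_subseq hbdd
  have hlu : Filter.Tendsto (fun n => u (φ (θ n))) Filter.atTop (nhds v) :=
    (continuous_fst.tendsto _).comp hlim
  have hlp : Filter.Tendsto (fun n => p (φ (θ n))) Filter.atTop (nhds y) :=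
    (continuous_snd.tendsto _).comp hlim
  have hv : IsDouglasRachfordFixed f C v y :=
    isDouglasRachfordFixed_of_tendsto hfc hCcl (fun n => hp (φ (θ n))) (fun n => hq (φ (θ n)))
      hlu hlp (hd.comp hθ.tendsto_atTop)
  obtain ⟨l, hl⟩ := hfejer v y hv
  have hl0 : l = 0 := tendsto_nhds_unique
    (hl.comp (hφ.comp hθ).tendsto_atTop) (tendsto_iff_norm_sub_tendsto_zero.1 hlu)
  rw [hl0] at hl
  have hpl : Filter.Tendsto p Filter.atTop (nhds y) :=
    tendsto_iff_norm_sub_tendsto_zero.2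
      (squeeze_zero (fun _ => norm_nonneg _) (fun k => (hp k).norm_sub_le hv.1) hl)
  have he1 : Filter.Tendsto e1 Filter.atTop (nhds 0) :=
    squeeze_zero_norm (fun k => by linarith [norm_nonneg (e2 k)]) herr.tendsto_atTop_zero
  refine ⟨⟨v, tendsto_iff_norm_sub_tendsto_zero.2 hl⟩, y, hv.2.1, fun w hw => hv.isMinOn hw, ?_⟩
  rw [← Filter.tendsto_add_atTop_iff_nat 1]
  simpa [hp_def] using hpl.add he1
end
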